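/- arXiv:2009.05084 — 2 statements merged into one kernel-verified Lean document; each statement's English description precedes it below -/
import Mathlib

section
/- Let p be a prime, k a field of characteristic p, and Q a relatively perfect k-algebra. Then Q is geometrically reduced over k; that is, Q ⊗_k K is a reduced ring, where K is an algebraic closure of k. In particular, Q itself is reduced. -/
open scoped TensorProduct


namespace Paper

theorem cast_p_zero (p : ℕ) (R Q : Type*) [CommRing R] [CommRing Q] [Algebra R Q]
    [CharP R p] : (p : Q) = 0 := by
  have h : ((p : ℕ) : Q) = algebraMap R Q ((p : ℕ) : R) := by rw [map_natCast]
  rw [h, CharP.cast_eq_zero, map_zero]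

theorem charP_of_nontrivial (p : ℕ) [Fact p.Prime] (R Q : Type*) [CommRing R] [CommRing Q]
    [Algebra R Q] [CharP R p] [Nontrivial Q] : CharP Q p := by
  have hp : (p : Q) = 0 := cast_p_zero p R Q
  have hdvd : ringChar Q ∣ p := ringChar.dvd hp
  rcases (Fact.out : p.Prime).eq_one_or_self_of_dvd _ hdvd with h1 | h1
  · exact absurd h1 CharP.ringChar_ne_one
  · exact ringChar.of_eq h1

theorem add_pow_p_iter (p : ℕ) [Fact p.Prime] (R Q : Type*) [CommRing R] [CommRing Q]
    [Algebra R Q] [CharP R p] (r : ℕ) (x y : Q) :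
    (x + y) ^ p ^ r = x ^ p ^ r + y ^ p ^ r := by
  rcases subsingleton_or_nontrivial Q with h | h
  · exact Subsingleton.elim _ _
  · haveI : CharP Q p := charP_of_nontrivial p R Q
    exact add_pow_char_pow x y p r

/-- The `p`-th power map `x ↦ x ^ p` of an algebra `Q` over a ring `R` of
characteristic `p`, as a ring homomorphism. -/
def pthPow (p : ℕ) [Fact p.Prime] (R Q : Type*) [CommRing R] [CommRing Q]
    [Algebra R Q] [CharP R p] : Q →+* Q where
  toFun x := x ^ p
  map_one' := one_pow p
  map_mul' x y := mul_pow x y p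
  map_zero' := zero_pow (Fact.out : p.Prime).ne_zero
  map_add' x y := by simpa using add_pow_p_iter p R Q 1 x y

@[simp] theorem pthPow_apply (p : ℕ) [Fact p.Prime] (R Q : Type*) [CommRing R] [CommRing Q]
    [Algebra R Q] [CharP R p] (x : Q) : pthPow p R Q x = x ^ p := rfl

/-- The `pʳ`-th power map `x ↦ x ^ p ^ r` of an algebra `Q` over a ring `R` of
characteristic `p`, as a ring homomorphism. -/
def pthPowIter (p : ℕ) [Fact p.Prime] (R Q : Type*) [CommRing R] [CommRing Q]
    [Algebra R Q] [CharP R p] (r : ℕ) : Q →+* Q where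
  toFun x := x ^ p ^ r
  map_one' := one_pow _
  map_mul' x y := mul_pow x y _
  map_zero' := zero_pow (pow_ne_zero r (Fact.out : p.Prime).ne_zero)
  map_add' x y := add_pow_p_iter p R Q r x y

@[simp] theorem pthPowIter_apply (p : ℕ) [Fact p.Prime] (R Q : Type*) [CommRing R] [CommRing Q]
    [Algebra R Q] [CharP R p] (r : ℕ) (x : Q) : pthPowIter p R Q r x = x ^ p ^ r := rfl

/-- Type synonym: `R` regarded as an algebra over itself via the Frobenius `a ↦ a ^ p`. -/
def FrobTwist (_p : ℕ) (R : Type*) : Type _ := R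

instance (p : ℕ) (R : Type*) [CommRing R] : CommRing (FrobTwist p R) :=
  inferInstanceAs (CommRing R)

instance (p : ℕ) [Fact p.Prime] (R : Type*) [CommRing R] [CharP R p] :
    Algebra R (FrobTwist p R) :=
  (pthPow p R R).toAlgebra

theorem algebraMap_frobTwist_apply (p : ℕ) [Fact p.Prime] (R : Type*) [CommRing R] [CharP R p]
    (r : R) : algebraMap R (FrobTwist p R) r = (r ^ p : R) := rfl

/-- Type synonym: `Q` regarded as an `R`-algebra via `r ↦ g (r ^ p)` where `g : R → Q`
is the structure map. -/
def FrobTarget (_p : ℕ) (R Q : Type*) : Type _ := Q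

instance (p : ℕ) (R Q : Type*) [CommRing Q] : CommRing (FrobTarget p R Q) :=
  inferInstanceAs (CommRing Q)

instance (p : ℕ) [Fact p.Prime] (R Q : Type*) [CommRing R] [CommRing Q] [Algebra R Q]
    [CharP R p] : Algebra R (FrobTarget p R Q) :=
  ((algebraMap R Q).comp (pthPow p R R)).toAlgebra

/-- The canonical homomorphism `Q ⊗_{R, Frob} R → Q`, `x ⊗ y ↦ x ^ p · g y`, where the
tensor product is formed with `R` acting on the right-hand factor through the Frobenius
endomorphism `a ↦ a ^ p` of `R`. -/
noncomputable def relPerfHom (p : ℕ) [Fact p.Prime] (R Q : Type*) [CommRing R] [CommRing Q]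
    [Algebra R Q] [CharP R p] :
    (Q ⊗[R] FrobTwist p R) →ₐ[R] FrobTarget p R Q :=
  Algebra.TensorProduct.lift
    { toRingHom := pthPow p R Q
      commutes' := fun r => by
        show (algebraMap R Q r) ^ p = (algebraMap R Q) (r ^ p)
        rw [map_pow] }
    { toRingHom := algebraMap R Q
      commutes' := fun r => rfl }
    (fun x y => Commute.all _ _)

theorem relPerfHom_tmul (p : ℕ) [Fact p.Prime] (R Q : Type*) [CommRing R] [CommRing Q]
    [Algebra R Q] [CharP R p] (x : Q) (y : R) :
    (relPerfHom p R Q (x ⊗ₜ[R] (show FrobTwist p R from y)) : Q)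
      = x ^ p * algebraMap R Q y := by
  simp [relPerfHom, Algebra.TensorProduct.lift_tmul]
  rfl

/-- `Q` is relatively perfect over `R` if the canonical map
`Q ⊗_{R, Frob} R → Q`, `x ⊗ y ↦ x ^ p · g y`, is bijective. -/
def IsRelativelyPerfect (p : ℕ) [Fact p.Prime] (R Q : Type*) [CommRing R] [CommRing Q]
    [Algebra R Q] [CharP R p] : Prop :=
  Function.Bijective (relPerfHom p R Q)

/-- `Q` is relatively semi-perfect over `R` if the canonical map
`Q ⊗_{R, Frob} R → Q`, `x ⊗ y ↦ x ^ p · g y`, is surjective. -/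
def IsRelativelySemiperfect (p : ℕ) [Fact p.Prime] (R Q : Type*) [CommRing R] [CommRing Q]
    [Algebra R Q] [CharP R p] : Prop :=
  Function.Surjective (relPerfHom p R Q)

end Paper

namespace Paper

/-- An algebra over a reduced ring of characteristic `p` is reduced as soon as the `p`-th powers of
the elements of some basis are linearly independent. -/
theorem isReduced_of_linearIndependent_pow (p : ℕ) [Fact p.Prime] {R A ι : Type*} [CommRing R]
    [CommRing A] [Algebra R A] [CharP R p] [IsReduced R] (b : Module.Basis ι R A)
    (h : LinearIndependent R fun i => b i ^ p) : IsReduced A := by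
  rw [isReduced_iff_pow_one_lt p (Fact.out : p.Prime).one_lt]
  intro x hx
  have hsum : ∑ i ∈ (b.repr x).support, b.repr x i ^ p • b i ^ p = 0 := by
    conv_lhs at hx => rw [← b.linearCombination_repr x, Finsupp.linearCombination_apply,
      Finsupp.sum, ← pthPow_apply p R, map_sum]
    simpa [smul_pow] using hx
  have hcoord : ∀ i ∈ (b.repr x).support, b.repr x i ^ p = 0 :=
    linearIndependent_iff'.mp h _ _ hsum
  refine b.repr.map_eq_zero_iff.mp (Finsupp.ext fun i => ?_)
  by_contra hi
  exact hi (eq_zero_of_pow_eq_zero (hcoord i (Finsupp.mem_support_iff.mpr hi)))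

/-- If the relative Frobenius of `Q` is injective, then the `p`-th powers of the elements of a
basis of `Q` are linearly independent. -/
theorem linearIndependent_pow_of_injective_relPerfHom (p : ℕ) [Fact p.Prime] {R Q ι : Type*}
    [CommRing R] [CommRing Q] [Algebra R Q] [CharP R p]
    (hinj : Function.Injective (relPerfHom p R Q)) (b : Module.Basis ι R Q) :
    LinearIndependent R fun i => b i ^ p := by
  classical
  rw [linearIndependent_iff]
  intro c hc
  let d : ι →₀ FrobTwist p R := c
  have hd : (d.sum fun i r => b i ⊗ₜ[R] r) = 0 := by
    apply hinj
    rw [map_zero, Finsupp.sum, map_sum]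
    refine Eq.trans (Finset.sum_congr rfl fun i _ => ?_) hc
    refine (relPerfHom_tmul p R Q (b i) (c i)).trans ?_
    rw [mul_comm, ← Algebra.smul_def]
    rfl
  exact TensorProduct.sum_tmul_basis_left_eq_zero b d hd

section Statement5

/-- A relatively perfect algebra `Q` over a field `k` of characteristic
`p` is geometrically reduced: `Q ⊗_k K` is reduced for an algebraic closure `K` of `k`;
in particular, `Q` itself is reduced. -/
theorem statement5 (p : ℕ) [Fact p.Prime] (k Q : Type*) [Field k] [CharP k p]
    [CommRing Q] [Algebra k Q] (hrp : IsRelativelyPerfect p k Q) :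
    IsReduced (Q ⊗[k] AlgebraicClosure k) ∧ IsReduced Q := by
  have : CharP (AlgebraicClosure k) p := charP_of_nontrivial p k (AlgebraicClosure k)
  let b := Module.Basis.ofVectorSpace k Q
  have hb := linearIndependent_pow_of_injective_relPerfHom p hrp.injective b
  have hreduced : IsReduced (AlgebraicClosure k ⊗[k] Q) := by
    refine isReduced_of_linearIndependent_pow p (b.baseChange (AlgebraicClosure k)) ?_
    simpa [Algebra.TensorProduct.tmul_pow] using
      Module.Flat.linearIndependent_one_tmul (S := AlgebraicClosure k) hb
  exact ⟨isReduced_of_injective (Algebra.TensorProduct.comm k Q (AlgebraicClosure k))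
    (AlgEquiv.injective _), isReduced_of_linearIndependent_pow p b hb⟩

end Statement5

end Paper
end

section
/- Let k be a field and k' a finite field extension of k. Let R be a commutative k-algebra and let S' be an R ⊗_k k'-algebra that is étale and faithfully flat over R ⊗_k k'. Then there exist a commutative R-algebra S that is étale and faithfully flat over R, and an R ⊗_k k'-algebra homomorphism S' → S ⊗_k k'. -/
open scoped TensorProduct

namespace Paper

universe u

section WeilRestriction

variable {R A : Type u} [CommRing R] [CommRing A] [Algebra R A]

lemma equivFinsuppOfBasisLeft_map {ι : Type*} [DecidableEq ι] (b : Module.Basis ι R A)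
    {P T : Type*} [CommRing P] [CommRing T] [Algebra R P] [Algebra R T] (g : P →ₐ[R] T)
    (x : A ⊗[R] P) (j : ι) :
    TensorProduct.equivFinsuppOfBasisLeft b
      (Algebra.TensorProduct.map (AlgHom.id A A) g x) j =
      g (TensorProduct.equivFinsuppOfBasisLeft b x j) := by
  induction x with
  | zero => simp
  | add x y hx hy => simp only [map_add, Finsupp.add_apply, hx, hy]
  | tmul a p => simp

/-- The Weil restriction of a finitely presented algebra along a finite free ring extension. -/
theorem exists_weilRestriction [Module.Free R A] [Module.Finite R A]
    (S' : Type u) [CommRing S'] [Algebra A S'] [Algebra.FinitePresentation A S'] :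
    ∃ (S : Type u) (_ : CommRing S) (_ : Algebra R S) (φ : S' →ₐ[A] A ⊗[R] S),
      Algebra.FinitePresentation R S ∧
      ∀ (T : Type u) [CommRing T] [Algebra R T], Function.Bijective
        fun g : S →ₐ[R] T ↦ (Algebra.TensorProduct.map (AlgHom.id A A) g).comp φ := by
  classical
  obtain ⟨n, f, hf, s, hs⟩ := Algebra.FinitePresentation.out (R := A) (A := S')
  let ι := Module.Free.ChooseBasisIndex R A
  let b : Module.Basis ι R A := Module.Free.chooseBasis R A
  let P := MvPolynomial (Fin n × ι) R
  let e (T : Type u) [CommRing T] [Algebra R T] := TensorProduct.equivFinsuppOfBasisLeft (N := T) b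
  let u : MvPolynomial (Fin n) A →ₐ[A] A ⊗[R] P :=
    MvPolynomial.aeval fun i ↦ ∑ j, b j ⊗ₜ[R] MvPolynomial.X (i, j)
  let J : Ideal P := Ideal.span (s.biUnion fun p ↦ Finset.univ.image fun j ↦ e P (u p) j)
  have map_u (T : Type u) [CommRing T] [Algebra R T] (g : P →ₐ[R] T) (i : Fin n) :
      Algebra.TensorProduct.map (AlgHom.id A A) g (u (MvPolynomial.X i)) =
        ∑ j, b j ⊗ₜ[R] g (MvPolynomial.X (i, j)) := by
    simp [u]
  have e_sum (T : Type u) [CommRing T] [Algebra R T] (t : ι → T) (j : ι) :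
      e T (∑ j, b j ⊗ₜ[R] t j) j = t j := by
    simp [e, Finsupp.finsetSum_apply, Finsupp.single_apply]
  obtain ⟨Q, _, _, π, hπs, hπJ⟩ : ∃ (Q : Type u) (_ : CommRing Q) (_ : Algebra R Q)
      (π : P →ₐ[R] Q), Function.Surjective π ∧ RingHom.ker π = J :=
    ⟨P ⧸ J, inferInstance, inferInstance, Ideal.Quotient.mkₐ R J,
      Ideal.Quotient.mkₐ_surjective R J, Ideal.Quotient.mkₐ_ker R J⟩
  have hπ : RingHom.ker f.toRingHom ≤
      RingHom.ker ((Algebra.TensorProduct.map (AlgHom.id A A) π).comp u).toRingHom := by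
    rw [← hs]
    refine Ideal.span_le.2 fun p hp ↦ ?_
    change Algebra.TensorProduct.map (AlgHom.id A A) π (u p) = 0
    apply (e _).injective
    ext j
    rw [equivFinsuppOfBasisLeft_map b]
    simp only [map_zero, Finsupp.zero_apply]
    rw [← RingHom.mem_ker, hπJ]
    refine Ideal.subset_span ?_
    simp only [Finset.coe_biUnion, Set.mem_iUnion]
    exact ⟨p, hp, by simp [e]⟩
  have map_map (T : Type u) [CommRing T] [Algebra R T] (g : Q →ₐ[R] T) (x : A ⊗[R] P) :
      Algebra.TensorProduct.map (AlgHom.id A A) g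
        (Algebra.TensorProduct.map (AlgHom.id A A) π x) =
      Algebra.TensorProduct.map (AlgHom.id A A) (g.comp π) x := by
    rw [← AlgHom.comp_apply, ← Algebra.TensorProduct.map_comp, AlgHom.comp_id]
  obtain ⟨φ, hφ⟩ : ∃ φ : S' →ₐ[A] A ⊗[R] Q, ∀ x,
      φ (f x) = Algebra.TensorProduct.map (AlgHom.id A A) π (u x) :=
    ⟨AlgHom.liftOfSurjective f hf _ hπ, AlgHom.liftOfSurjective_apply f hf _ hπ⟩
  refine ⟨Q, inferInstance, inferInstance, φ, ?_, fun T _ _ ↦ ⟨fun g₁ g₂ h ↦ ?_, fun ψ ↦ ?_⟩⟩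
  · exact Algebra.FinitePresentation.of_surjective hπs (hπJ ▸ ⟨_, rfl⟩)
  · refine (AlgHom.cancel_right hπs).1 (MvPolynomial.algHom_ext fun ⟨i, j⟩ ↦ ?_)
    have h1 := DFunLike.congr_fun h (f (MvPolynomial.X i))
    simp only [AlgHom.comp_apply, hφ] at h1
    rw [map_map, map_map, map_u, map_u] at h1
    have h2 := congrArg (fun z ↦ e T z j) h1
    rw [e_sum, e_sum] at h2
    exact h2
  · let c : Fin n → ι →₀ T := fun i ↦ e T (ψ (f (MvPolynomial.X i)))
    let g₀ : P →ₐ[R] T := MvPolynomial.aeval fun ij ↦ c ij.1 ij.2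
    have hg₀ : (Algebra.TensorProduct.map (AlgHom.id A A) g₀).comp u = ψ.comp f := by
      refine MvPolynomial.algHom_ext fun i ↦ ?_
      refine (map_u T g₀ i).trans ((e T).injective (Finsupp.ext fun j ↦ ?_))
      rw [e_sum]
      exact MvPolynomial.aeval_X _ _
    have hJ : RingHom.ker π.toRingHom ≤ RingHom.ker g₀.toRingHom := by
      refine hπJ.trans_le ?_
      refine Ideal.span_le.2 fun x hx ↦ ?_
      simp only [Finset.coe_biUnion, Set.mem_iUnion, Finset.coe_image, Set.mem_image] at hx
      obtain ⟨p, hp, j, -, rfl⟩ := hx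
      have hfp : f p = 0 := by
        change p ∈ RingHom.ker f.toRingHom
        exact hs ▸ Ideal.subset_span hp
      have h1 := DFunLike.congr_fun hg₀ p
      simp only [AlgHom.comp_apply, hfp, map_zero] at h1
      change g₀ (e P (u p) j) = 0
      rw [← equivFinsuppOfBasisLeft_map b, h1, map_zero, Finsupp.zero_apply]
    refine ⟨AlgHom.liftOfSurjective π hπs g₀ hJ, AlgHom.ext fun x ↦ ?_⟩
    obtain ⟨x, rfl⟩ := hf x
    refine Eq.trans ?_ (DFunLike.congr_fun hg₀ x)
    simp only [AlgHom.comp_apply, hφ]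
    rw [map_map, AlgHom.liftOfSurjective_comp]

/-- A finite algebra over an algebraically closed field, over `A`, receives a map from any
faithfully flat étale `A`-algebra. -/
theorem nonempty_algHom_of_finite_isAlgClosed (S' : Type u) [CommRing S'] [Algebra A S']
    [Algebra.Etale A S'] [Module.FaithfullyFlat A S']
    (K B : Type u) [Field K] [IsAlgClosed K] [CommRing B] [Algebra K B] [Module.Finite K B]
    [Algebra A B] : Nonempty (S' →ₐ[A] B) := by
  have : IsArtinianRing B := IsArtinianRing.of_finite K B
  have key (m : MaximalSpectrum B) : Nonempty (S' →ₐ[A] B ⧸ m.asIdeal) := by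
    let := Ideal.Quotient.field m.asIdeal
    obtain ⟨M, hM⟩ := Ideal.exists_maximal ((B ⧸ m.asIdeal) ⊗[A] S')
    let := Ideal.Quotient.field M
    let L := ((B ⧸ m.asIdeal) ⊗[A] S') ⧸ M
    have : Algebra.FiniteType (B ⧸ m.asIdeal) L := inferInstance
    have : Module.Finite (B ⧸ m.asIdeal) L := finite_of_finite_type_of_isJacobsonRing _ _
    have : IsAlgClosed (B ⧸ m.asIdeal) := .of_ringEquiv K _ (RingEquiv.ofBijective _
      (IsAlgClosed.algebraMap_bijective_of_isIntegral (k := K) (K := B ⧸ m.asIdeal)))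
    let e := AlgEquiv.ofBijective (Algebra.ofId (B ⧸ m.asIdeal) L)
      IsAlgClosed.algebraMap_bijective_of_isIntegral
    exact ⟨((e.symm.toAlgHom.comp (Ideal.Quotient.mkₐ (B ⧸ m.asIdeal) M)).restrictScalars A).comp
      Algebra.TensorProduct.includeRight⟩
  let p (m : MaximalSpectrum B) := (key m).some
  let q : S' →ₐ[A] B ⧸ nilradical B :=
    ((IsArtinianRing.quotNilradicalEquivPi B).symm.toAlgHom.restrictScalars A).comp
      (AlgHom.pi p)
  exact ⟨Algebra.FormallySmooth.lift _ IsArtinianRing.isNilpotent_nilradical q⟩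

/-- Homomorphisms out of a Weil restriction of a formally étale algebra lift uniquely along
surjections with square-zero kernel. -/
theorem bijective_comp_of_weilRestriction {S' S : Type u} [CommRing S'] [Algebra A S']
    [Algebra.FormallyEtale A S'] [CommRing S] [Algebra R S] (φ : S' →ₐ[A] A ⊗[R] S)
    (hφ : ∀ (T : Type u) [CommRing T] [Algebra R T], Function.Bijective
        fun g : S →ₐ[R] T ↦ (Algebra.TensorProduct.map (AlgHom.id A A) g).comp φ)
    {T Q : Type u} [CommRing T] [Algebra R T] [CommRing Q] [Algebra R Q] (π : T →ₐ[R] Q)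
    (hπ : Function.Surjective π) (hker : RingHom.ker π ^ 2 = ⊥) :
    Function.Bijective (π.comp : (S →ₐ[R] T) → (S →ₐ[R] Q)) := by
  let q : A ⊗[R] T →ₐ[A] A ⊗[R] Q := Algebra.TensorProduct.map (AlgHom.id A A) π
  have hq : Function.Surjective q :=
    Algebra.TensorProduct.map_surjective (AlgHom.id A A) π Function.surjective_id hπ
  have hnil : IsNilpotent (RingHom.ker (q : A ⊗[R] T →+* A ⊗[R] Q)) := by
    refine ⟨2, ?_⟩
    have h : RingHom.ker (q : A ⊗[R] T →+* A ⊗[R] Q) = (RingHom.ker π).map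
        (Algebra.TensorProduct.includeRight : T →ₐ[R] A ⊗[R] T) :=
      Algebra.TensorProduct.lTensor_ker π hπ
    rw [h, ← Ideal.map_pow, hker, Ideal.map_bot, Ideal.zero_eq_bot]
  have comp_eq (g : S →ₐ[R] T) :
      (Algebra.TensorProduct.map (AlgHom.id A A) (π.comp g)).comp φ =
        q.comp ((Algebra.TensorProduct.map (AlgHom.id A A) g).comp φ) := by
    rw [← AlgHom.comp_assoc, ← Algebra.TensorProduct.map_comp, AlgHom.comp_id]
  refine ⟨fun g₁ g₂ h ↦ (hφ T).1 ?_, fun g ↦ ?_⟩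
  · refine Algebra.FormallyUnramified.lift_unique' q hnil _ _ ?_
    rw [← comp_eq, ← comp_eq, h]
  · obtain ⟨g', hg'⟩ := (hφ T).2 (Algebra.FormallySmooth.liftOfSurjective
      ((Algebra.TensorProduct.map (AlgHom.id A A) g).comp φ) q hq hnil)
    refine ⟨g', (hφ Q).1 ?_⟩
    dsimp only at hg' ⊢
    rw [comp_eq, hg', Algebra.FormallySmooth.comp_liftOfSurjective]

/-- A faithfully flat étale algebra over a finite free extension of `R` is dominated by the base
change of a faithfully flat étale `R`-algebra. -/
theorem exists_etale_faithfullyFlat_descent [Module.Free R A] [Module.Finite R A]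
    (S' : Type u) [CommRing S'] [Algebra A S'] [Algebra.Etale A S'] [Module.FaithfullyFlat A S'] :
    ∃ (S : Type u) (_ : CommRing S) (_ : Algebra R S),
      Algebra.Etale R S ∧ Module.FaithfullyFlat R S ∧ Nonempty (S' →ₐ[A] A ⊗[R] S) := by
  obtain ⟨S, _, _, φ, hfp, hS⟩ := exists_weilRestriction (R := R) (A := A) S'
  have : Algebra.FormallyEtale R S :=
    Algebra.FormallyEtale.iff_comp_bijective.2 fun T _ _ I hI ↦
      bijective_comp_of_weilRestriction φ hS (Ideal.Quotient.mkₐ R I)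
        (Ideal.Quotient.mkₐ_surjective R I) ((Ideal.Quotient.mkₐ_ker R I).symm ▸ hI)
  have het : Algebra.Etale R S := {}
  refine ⟨S, inferInstance, inferInstance, het, .of_comap_surjective fun p ↦ ?_, ⟨φ⟩⟩
  let K : Type u := AlgebraicClosure p.asIdeal.ResidueField
  let : Algebra K (A ⊗[R] K) := Algebra.TensorProduct.rightAlgebra
  have : Module.Finite K (A ⊗[R] K) :=
    .equiv (Algebra.TensorProduct.commRight R K A).toLinearEquiv
  obtain ⟨ψ⟩ := nonempty_algHom_of_finite_isAlgClosed (A := A) S' K (A ⊗[R] K)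
  obtain ⟨g, -⟩ := (hS K).2 ψ
  refine ⟨⟨RingHom.ker g, RingHom.ker_isPrime _⟩, ?_⟩
  ext x
  change g (algebraMap R S x) = 0 ↔ x ∈ p.asIdeal
  rw [AlgHom.commutes, IsScalarTower.algebraMap_apply R p.asIdeal.ResidueField K, map_eq_zero,
    Ideal.algebraMap_residueField_eq_zero]

end WeilRestriction

/-- Let `k'/k` be a finite field extension, `R` a commutative
`k`-algebra and `S'` an `R ⊗_k k'`-algebra that is étale and faithfully flat.  Then there
exist an étale faithfully flat `R`-algebra `S` and an `R ⊗_k k'`-algebra homomorphism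
`S' → S ⊗_k k'`. -/
theorem statement12 (k k' R S' : Type u) [Field k] [Field k'] [Algebra k k']
    [FiniteDimensional k k'] [CommRing R] [Algebra k R] [CommRing S']
    [Algebra (R ⊗[k] k') S'] [Algebra.Etale (R ⊗[k] k') S']
    [Module.FaithfullyFlat (R ⊗[k] k') S'] :
    ∃ (S : Type u) (_ : CommRing S) (_ : Algebra k S) (_ : Algebra R S)
      (_ : IsScalarTower k R S),
      Algebra.Etale R S ∧ Module.FaithfullyFlat R S ∧
      ∃ φ : S' →+* (S ⊗[k] k'),
        φ.comp (algebraMap (R ⊗[k] k') S')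
          = (Algebra.TensorProduct.map (IsScalarTower.toAlgHom k R S)
              (AlgHom.id k k')).toRingHom := by
  obtain ⟨S, _, _, h₁, h₂, ⟨φ⟩⟩ :=
    exists_etale_faithfullyFlat_descent (R := R) (A := R ⊗[k] k') S'
  let : Algebra k S := Algebra.compHom S (algebraMap k R)
  have : IsScalarTower k R S := .of_algebraMap_eq fun _ ↦ rfl
  let f : R ⊗[k] k' →ₐ[R] S ⊗[k] k' := Algebra.TensorProduct.map (Algebra.ofId R S) (AlgHom.id k k')
  let ψ : (R ⊗[k] k') ⊗[R] S →ₐ[R] S ⊗[k] k' :=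
    Algebra.TensorProduct.productMap f
      (Algebra.TensorProduct.includeLeft : S →ₐ[R] S ⊗[k] k')
  refine ⟨S, _, _, _, inferInstance, h₁, h₂, ψ.toRingHom.comp φ.toRingHom, ?_⟩
  have hψ : (ψ.toRingHom.comp φ.toRingHom).comp (algebraMap (R ⊗[k] k') S') = f.toRingHom :=
    RingHom.ext fun x ↦ by
      have h : ψ (φ (algebraMap _ _ x)) = f x := by
        rw [φ.commutes]
        exact (Algebra.TensorProduct.productMap_left_apply _ _ x)
      exact h
  rw [hψ]
  refine RingHom.ext fun x ↦ ?_
  induction x with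
  | zero => simp only [map_zero]
  | add x y hx hy => rw [map_add, map_add, hx, hy]
  | tmul x y => rfl

end Paper
end
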